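/- arXiv:2106.03107 — 2 statements merged into one kernel-verified Lean document; each statement's English description precedes it below -/
import Mathlib

section
/- The map k ↦ adapt(k) is nonincreasing; adapt(k) ≥ opt(2RO) for every integer k ≥ 1; and adapt(k) = opt(2RO) for every integer k ≥ n+1. -/
open scoped BigOperators

/-- Dot product of two vectors in `ℝ^ν`. -/
noncomputable def dot {ν : ℕ} (c x : Fin ν → ℝ) : ℝ := ∑ j, c j * x j

/-- `convComb S k` is the set of all convex combinations of at most `k` points of `S`. -/
def convComb {ν : ℕ} (S : Set (Fin ν → ℝ)) (k : ℕ) : Set (Fin ν → ℝ) :=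
  { x | ∃ (xs : Fin k → (Fin ν → ℝ)) (lam : Fin k → ℝ),
      (∀ i, xs i ∈ S) ∧ (∀ i, 0 ≤ lam i) ∧ (∑ i, lam i) = 1 ∧
      x = ∑ i, lam i • xs i }

/-- `‖y‖₀`, the number of nonzero entries of `y`, as a real number. -/
noncomputable def zeroNorm {ν : ℕ} (y : Fin ν → ℝ) : ℝ :=
  ((Finset.univ.filter (fun j => y j ≠ 0)).card : ℝ)

/-- The `k`-adaptability value
`adapt(k) = inf_{x ∈ X, y¹,…,y^k ∈ Y(x)} max_{ξ ∈ U} min_{i=1,…,k} (dᵀx + ξᵀyⁱ)`. -/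
noncomputable def adaptVal {μ ν : ℕ} (X : Set (Fin μ → ℝ)) (d : Fin μ → ℝ)
    (Y : (Fin μ → ℝ) → Set (Fin ν → ℝ)) (U : Set (Fin ν → ℝ)) (k : ℕ) : ℝ :=
  sInf { v : ℝ | ∃ x ∈ X, ∃ ys : Fin k → (Fin ν → ℝ), (∀ i, ys i ∈ Y x) ∧
    v = sSup ((fun ξ => dot d x + ⨅ i, dot ξ (ys i)) '' U) }

/-- The two-stage robust value
`opt(2RO) = inf_{x ∈ X} max_{ξ ∈ U} min_{y ∈ Y(x)} (dᵀx + ξᵀy)`. -/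
noncomputable def twoStageVal {μ ν : ℕ} (X : Set (Fin μ → ℝ)) (d : Fin μ → ℝ)
    (Y : (Fin μ → ℝ) → Set (Fin ν → ℝ)) (U : Set (Fin ν → ℝ)) : ℝ :=
  sInf { v : ℝ | ∃ x ∈ X, v = sSup ((fun ξ => dot d x + ⨅ y : (Y x), dot ξ (y : Fin ν → ℝ)) '' U) }

/-- The worst-case cost `max_{ξ ∈ U} min_i (c + ξᵀyⁱ)` of a family of second-stage decisions. -/
noncomputable def worstCost {ν : ℕ} {ι : Type*} (c : ℝ) (U : Set (Fin ν → ℝ))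
    (ys : ι → Fin ν → ℝ) : ℝ :=
  sSup ((fun ξ => c + ⨅ i, dot ξ (ys i)) '' U)

lemma continuous_dot_left {ν : ℕ} (y : Fin ν → ℝ) : Continuous fun ξ => dot ξ y := by
  unfold dot
  fun_prop

lemma continuous_dot_right {ν : ℕ} (c : Fin ν → ℝ) : Continuous fun x => dot c x := by
  unfold dot
  fun_prop

lemma convex_setOf_lt_dot {ν : ℕ} (y : Fin ν → ℝ) (v : ℝ) : Convex ℝ {ξ | v < dot ξ y} := by
  refine convex_halfSpace_gt ⟨fun a b => ?_, fun r a => ?_⟩ v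
  · simp [dot, add_mul, Finset.sum_add_distrib]
  · simp [dot, mul_assoc, Finset.mul_sum]

lemma neg_sum_abs_le_dot {ν : ℕ} (ξ y : Fin ν → ℝ) (hy : ∀ j, y j = 0 ∨ y j = 1) :
    -∑ j, |ξ j| ≤ dot ξ y := by
  rw [dot, ← Finset.sum_neg_distrib]
  refine Finset.sum_le_sum fun j _ => ?_
  rcases hy j with h | h
  · simp [h]
  · simpa [h] using neg_abs_le (ξ j)

lemma bddAbove_image_iInf_dot {ν : ℕ} {ι : Type*} [Finite ι] [Nonempty ι] (c : ℝ)
    {U : Set (Fin ν → ℝ)} (hU : IsCompact U) (ys : ι → Fin ν → ℝ) :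
    BddAbove ((fun ξ => c + ⨅ i, dot ξ (ys i)) '' U) := by
  obtain ⟨i⟩ := ‹Nonempty ι›
  obtain ⟨B, hB⟩ := hU.bddAbove_image (continuous_dot_left (ys i)).continuousOn
  refine ⟨c + B, ?_⟩
  rintro _ ⟨ξ, hξ, rfl⟩
  have h₁ : ⨅ i, dot ξ (ys i) ≤ dot ξ (ys i) := ciInf_le (Set.finite_range _).bddBelow i
  have h₂ : dot ξ (ys i) ≤ B := hB ⟨ξ, hξ, rfl⟩
  dsimp only
  linarith

lemma worstCost_anti {ν : ℕ} {ι κ : Type*} [Finite ι] [Nonempty ι] [Finite κ] [Nonempty κ] (c : ℝ)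
    {U : Set (Fin ν → ℝ)} (hU : IsCompact U) (hUne : U.Nonempty)
    {ys : ι → Fin ν → ℝ} {zs : κ → Fin ν → ℝ} (h : Set.range ys ⊆ Set.range zs) :
    worstCost c U zs ≤ worstCost c U ys := by
  refine csSup_le (hUne.image _) ?_
  rintro _ ⟨ξ, hξ, rfl⟩
  refine le_csSup_of_le (bddAbove_image_iInf_dot c hU ys) ⟨ξ, hξ, rfl⟩ ?_
  refine add_le_add le_rfl (le_ciInf fun i => ?_)
  obtain ⟨k, hk⟩ := h ⟨i, rfl⟩
  rw [← hk]
  exact ciInf_le (Set.finite_range fun k => dot ξ (zs k)).bddBelow k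

lemma le_worstCost {ν : ℕ} {ι : Type*} [Finite ι] [Nonempty ι] (c : ℝ)
    {U : Set (Fin ν → ℝ)} (hU : IsCompact U) {ξ : Fin ν → ℝ} (hξ : ξ ∈ U)
    {ys : ι → Fin ν → ℝ} (hys : ∀ i j, ys i j = 0 ∨ ys i j = 1) :
    c - ∑ j, |ξ j| ≤ worstCost c U ys := by
  refine le_csSup_of_le (bddAbove_image_iInf_dot c hU ys) ⟨ξ, hξ, rfl⟩ ?_
  rw [sub_eq_add_neg]
  exact add_le_add le_rfl (le_ciInf fun i => neg_sum_abs_le_dot ξ _ (hys i))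

/-- By Helly's theorem, at most `ν + 1` members of a finite family already attain its worst-case
cost over a convex set. -/
lemma exists_worstCost_le_of_succ_le {ν k : ℕ} {ι : Type*} [Finite ι] [Nonempty ι] (c : ℝ)
    {U : Set (Fin ν → ℝ)} (hU : IsCompact U) (hUne : U.Nonempty) (hUconv : Convex ℝ U)
    (ys : ι → Fin ν → ℝ) (hk : ν + 1 ≤ k) :
    ∃ f : Fin k → ι, worstCost c U (fun i => ys (f i)) ≤ worstCost c U ys := by
  classical
  have := Fintype.ofFinite ι
  set v := worstCost c U ys
  let F : ι → Set (Fin ν → ℝ) := fun i => U ∩ {ξ | v - c < dot ξ (ys i)}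
  have hempty : ¬ (⋂ i ∈ (Finset.univ : Finset ι), F i).Nonempty := by
    rintro ⟨ξ, hξ⟩
    simp only [Finset.mem_univ, Set.iInter_true, Set.mem_iInter] at hξ
    obtain ⟨i, hi⟩ := exists_eq_ciInf_of_finite (f := fun i => dot ξ (ys i))
    have h₁ : c + ⨅ i, dot ξ (ys i) ≤ v :=
      le_csSup (bddAbove_image_iInf_dot c hU ys) ⟨ξ, (hξ i).1, rfl⟩
    have h₂ : v - c < dot ξ (ys i) := (hξ i).2
    linarith
  obtain ⟨I, hIcard, hI⟩ : ∃ I : Finset ι, I.card ≤ ν + 1 ∧ ¬ (⋂ i ∈ I, F i).Nonempty := by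
    by_contra! h
    refine hempty (Convex.helly_theorem' (𝕜 := ℝ)
      (fun i _ => hUconv.inter (convex_setOf_lt_dot _ _)) fun I _ hI => ?_)
    exact h I (by simpa using hI)
  have hIne : I.Nonempty := by
    by_contra h
    rw [Finset.not_nonempty_iff_eq_empty] at h
    simp [h] at hI
  have : Nonempty I := hIne.to_subtype
  have : Nonempty (Fin k) := ⟨⟨0, by omega⟩⟩
  obtain ⟨e⟩ : Nonempty (I ↪ Fin k) :=
    Function.Embedding.nonempty_of_card_le (by simpa using hIcard.trans hk)
  refine ⟨fun i => (Function.invFun e i : I), csSup_le (hUne.image _) ?_⟩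
  rintro _ ⟨ξ, hξ, rfl⟩
  by_contra! hlt
  refine hI ⟨ξ, Set.mem_iInter₂.2 fun i hi => ⟨hξ, ?_⟩⟩
  have h := ciInf_le (Set.finite_range
    fun l => dot ξ (ys (Function.invFun e l : I))).bddBelow (e ⟨i, hi⟩)
  rw [Function.leftInverse_invFun e.injective] at h
  change v - c < dot ξ (ys i)
  dsimp only at hlt h
  linarith

/-- `k ↦ adapt(k)` is nonincreasing; `adapt(k) ≥ opt(2RO)` for all `k ≥ 1`;
and `adapt(k) = opt(2RO)` for every `k ≥ n+1`. -/
theorem stmt14 (m n : ℕ) (hm : 0 < m) (hn : 0 < n)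
    (X : Set (Fin m → ℝ)) (hXne : X.Nonempty) (hXcomp : IsCompact X)
    (d : Fin m → ℝ)
    (Y : (Fin m → ℝ) → Set (Fin n → ℝ))
    (hYfin : ∀ x ∈ X, (Y x).Finite) (hYne : ∀ x ∈ X, (Y x).Nonempty)
    (hYbin : ∀ x ∈ X, ∀ y ∈ Y x, ∀ j, y j = 0 ∨ y j = 1)
    (U : Set (Fin n → ℝ)) (hUne : U.Nonempty) (hUcomp : IsCompact U) (hUconv : Convex ℝ U) :
    (∀ k k' : ℕ, 1 ≤ k → k ≤ k' → adaptVal X d Y U k' ≤ adaptVal X d Y U k) ∧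
    (∀ k : ℕ, 1 ≤ k → twoStageVal X d Y U ≤ adaptVal X d Y U k) ∧
    (∀ k : ℕ, n + 1 ≤ k → adaptVal X d Y U k = twoStageVal X d Y U) := by
  obtain ⟨ξ₀, hξ₀⟩ := hUne
  have hUne : U.Nonempty := ⟨ξ₀, hξ₀⟩
  obtain ⟨A, hA⟩ := hXcomp.bddBelow_image (continuous_dot_right d).continuousOn
  replace hA : ∀ x ∈ X, A ≤ dot d x := fun x hx => hA ⟨x, hx, rfl⟩
  have hadapt (k : ℕ) (hk : 1 ≤ k) {x} (hx : x ∈ X) {ys : Fin k → Fin n → ℝ}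
      (hys : ∀ i, ys i ∈ Y x) : adaptVal X d Y U k ≤ worstCost (dot d x) U ys := by
    refine csInf_le ⟨A - ∑ j, |ξ₀ j|, ?_⟩ ⟨x, hx, ys, hys, rfl⟩
    rintro _ ⟨x, hx, ys, hys, rfl⟩
    have : Nonempty (Fin k) := ⟨⟨0, hk⟩⟩
    exact (sub_le_sub_right (hA x hx) _).trans
      (le_worstCost _ hUcomp hξ₀ fun i => hYbin x hx _ (hys i))
  have htwo {x} (hx : x ∈ X) :
      twoStageVal X d Y U ≤ worstCost (dot d x) U (Subtype.val : Y x → Fin n → ℝ) := by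
    refine csInf_le ⟨A - ∑ j, |ξ₀ j|, ?_⟩ ⟨x, hx, rfl⟩
    rintro _ ⟨x, hx, rfl⟩
    have : Finite (Y x) := hYfin x hx
    have : Nonempty (Y x) := (hYne x hx).to_subtype
    exact (sub_le_sub_right (hA x hx) _).trans
      (le_worstCost (ys := (Subtype.val : Y x → Fin n → ℝ)) _ hUcomp hξ₀
        fun y => hYbin x hx _ y.2)
  have hle_adapt (k : ℕ) {v : ℝ} (h : ∀ x ∈ X, ∀ ys : Fin k → Fin n → ℝ,
      (∀ i, ys i ∈ Y x) → v ≤ worstCost (dot d x) U ys) : v ≤ adaptVal X d Y U k := by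
    obtain ⟨x, hx⟩ := hXne
    obtain ⟨y, hy⟩ := hYne x hx
    refine le_csInf ⟨_, x, hx, fun _ => y, fun _ => hy, rfl⟩ ?_
    rintro _ ⟨x, hx, ys, hys, rfl⟩
    exact h x hx ys hys
  have htwo_le (k : ℕ) (hk : 1 ≤ k) : twoStageVal X d Y U ≤ adaptVal X d Y U k := by
    refine hle_adapt k fun x hx ys hys => (htwo hx).trans ?_
    have : Finite (Y x) := hYfin x hx
    have : Nonempty (Y x) := (hYne x hx).to_subtype
    have : Nonempty (Fin k) := ⟨⟨0, hk⟩⟩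
    refine worstCost_anti _ hUcomp hUne ?_
    rintro _ ⟨i, rfl⟩
    exact ⟨⟨ys i, hys i⟩, rfl⟩
  refine ⟨fun k k' hk hkk' => ?_, htwo_le, fun k hk => le_antisymm ?_ (htwo_le k (by omega))⟩
  · refine hle_adapt k fun x hx ys hys => ?_
    have : Nonempty (Fin k) := ⟨⟨0, hk⟩⟩
    have : Nonempty (Fin k') := ⟨⟨0, hk.trans hkk'⟩⟩
    have hinj := Fin.castLE_injective hkk'
    refine (hadapt k' (hk.trans hkk') hx
      (ys := fun i => ys (Function.invFun (Fin.castLE hkk') i)) fun i => hys _).trans ?_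
    refine worstCost_anti _ hUcomp hUne ?_
    rintro _ ⟨i, rfl⟩
    exact ⟨Fin.castLE hkk' i, congrArg ys (Function.leftInverse_invFun hinj i)⟩
  · obtain ⟨x₀, hx₀⟩ := hXne
    refine le_csInf ⟨_, x₀, hx₀, rfl⟩ ?_
    rintro _ ⟨x, hx, rfl⟩
    have : Finite (Y x) := hYfin x hx
    have : Nonempty (Y x) := (hYne x hx).to_subtype
    obtain ⟨f, hf⟩ := exists_worstCost_le_of_succ_le (dot d x) hUcomp hUne hUconv
      (Subtype.val : Y x → Fin n → ℝ) hk
    exact (hadapt k (by omega) hx fun i => (f i).2).trans hf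
end

section
/- Assume additionally p > 0 and dᵀx ≥ 0 for every x ∈ X. For all integers s, k with 1 ≤ s < k ≤ n it holds that adapt(s) ≤ (1 + M̃·(k−s)/(s+1))·adapt(k), where M̃ := (M_∞/m_∞)·(p̄/p); in particular, if p = p̄ then adapt(s) ≤ (1 + (M_∞/m_∞)·(k−s)/(s+1))·adapt(k). -/
open scoped BigOperators

/-- A convex set of points, each having some coordinate at most `w`, satisfies a single averaged
inequality with bound `w`. -/
theorem exists_convex_weights_le {ι : Type*} [Fintype ι] {A : Set (ι → ℝ)}
    (hA : Convex ℝ A) (hne : A.Nonempty) (w : ℝ) (h : ∀ a ∈ A, ∃ i, a i ≤ w) :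
    ∃ l : ι → ℝ, (∀ i, 0 ≤ l i) ∧ ∑ i, l i = 1 ∧ ∀ a ∈ A, ∑ i, l i * a i ≤ w := by
  classical
  have hQ : {z : ι → ℝ | ∀ i, w < z i} = Set.univ.pi fun _ => Set.Ioi w := by
    ext z; simp
  have hQc : Convex ℝ {z : ι → ℝ | ∀ i, w < z i} := by
    rw [hQ]; exact convex_pi fun i _ => convex_Ioi w
  have hQo : IsOpen {z : ι → ℝ | ∀ i, w < z i} := by
    rw [hQ]; exact isOpen_set_pi Set.finite_univ fun i _ => isOpen_Ioi
  have hdisj : Disjoint {z : ι → ℝ | ∀ i, w < z i} A := by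
    rw [Set.disjoint_left]
    intro a ha haA
    obtain ⟨i, hi⟩ := h a haA
    exact absurd (ha i) (not_lt.mpr hi)
  obtain ⟨f, u, hfQ, hfA⟩ := geometric_hahn_banach_open hQc hQo hA hdisj
  have hrep : ∀ z : ι → ℝ, f z = ∑ i, z i * f (Pi.single i 1) := by
    intro z
    conv_lhs => rw [pi_eq_sum_univ' z]
    simp only [map_sum, map_smul, smul_eq_mul]
  set g : ι → ℝ := fun i => -f (Pi.single i 1) with hg
  have hconst : ∀ c : ℝ, f (fun _ => c) = -(c * ∑ i, g i) := by
    intro c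
    rw [hrep]
    simp [hg, Finset.mul_sum]
  have hg0 : ∀ i, 0 ≤ g i := by
    intro i
    by_contra! hneg
    have key : ∀ t : ℝ, 0 ≤ t → -((w + 1) * ∑ j, g j) - t * g i < u := by
      intro t ht
      have := hfQ ((fun _ => w + 1) + t • Pi.single i (1 : ℝ)) (by
        intro j
        have : 0 ≤ (Pi.single i (1 : ℝ) : ι → ℝ) j := by
          rw [Pi.single_apply]; split_ifs <;> norm_num
        simp only [Pi.add_apply, Pi.smul_apply, smul_eq_mul]
        nlinarith [mul_nonneg ht this])
      rw [map_add, map_smul, hconst, smul_eq_mul] at this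
      simp only [hg] at this ⊢
      linarith
    have h1 := key (|u + (w + 1) * ∑ j, g j| / (-g i)) (by
      apply div_nonneg (abs_nonneg _); linarith)
    have h2 : |u + (w + 1) * ∑ j, g j| / (-g i) * g i = -|u + (w + 1) * ∑ j, g j| := by
      rw [div_neg, neg_mul, div_mul_cancel₀ _ hneg.ne]
    rw [h2] at h1
    linarith [le_abs_self (u + (w + 1) * ∑ j, g j)]
  have hbound : -u ≤ w * ∑ i, g i := by
    by_contra! hlt
    have hS : 0 ≤ ∑ i, g i := Finset.sum_nonneg fun i _ => hg0 i
    have key : ∀ e : ℝ, 0 < e → -u < (w + e) * ∑ i, g i := by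
      intro e he
      have := hfQ (fun _ => w + e) (fun i => by linarith)
      rw [hconst] at this
      linarith
    have hc : -u ≤ w * ∑ i, g i := by
      apply le_of_forall_pos_lt_add
      intro e he
      have h1 := key (e / (∑ i, g i + 1)) (by positivity)
      have h2 : e / (∑ i, g i + 1) * ∑ i, g i ≤ e := by
        rw [div_mul_eq_mul_div, div_le_iff₀ (by positivity)]
        nlinarith
      linarith
    linarith
  have hgA : ∀ a ∈ A, ∑ i, g i * a i ≤ -u := by
    intro a ha
    have := hfA a ha
    rw [hrep] at this
    have e : ∑ i, g i * a i = -∑ i, a i * f (Pi.single i 1) := by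
      rw [← Finset.sum_neg_distrib]
      exact Finset.sum_congr rfl fun i _ => by simp only [hg]; ring
    linarith
  have hSpos : 0 < ∑ i, g i := by
    refine lt_of_le_of_ne (Finset.sum_nonneg fun i _ => hg0 i) fun h0 => ?_
    have hz : ∀ i, g i = 0 := fun i =>
      (Finset.sum_eq_zero_iff_of_nonneg fun i _ => hg0 i).1 h0.symm i (Finset.mem_univ i)
    obtain ⟨a, ha⟩ := hne
    have h1 := hgA a ha
    have h2 := hfQ (fun _ => w + 1) (fun i => by linarith)
    rw [hconst, ← h0] at h2
    simp only [hz, zero_mul, Finset.sum_const_zero] at h1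
    linarith
  refine ⟨fun i => g i / ∑ j, g j, fun i => div_nonneg (hg0 i) hSpos.le, ?_, ?_⟩
  · rw [← Finset.sum_div, div_self hSpos.ne']
  · intro a ha
    have : ∑ i, g i / (∑ j, g j) * a i = (∑ i, g i * a i) / ∑ j, g j := by
      rw [Finset.sum_div]
      exact Finset.sum_congr rfl fun i _ => by ring
    rw [this, div_le_iff₀ hSpos]
    linarith [hgA a ha]

/-- Some subset of prescribed size carries at least its proportional share of the total weight. -/
theorem exists_subset_card_mul_sum_le {ι : Type*} [DecidableEq ι] (l : ι → ℝ) (s : ℕ)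
    (S : Finset ι) (hs : s ≤ S.card) :
    ∃ T ⊆ S, T.card = s ∧ (s : ℝ) * ∑ i ∈ S, l i ≤ S.card * ∑ i ∈ T, l i := by
  induction S using Finset.strongInduction with
  | H S ih =>
    rcases hs.eq_or_lt with rfl | hlt
    · exact ⟨S, subset_rfl, rfl, le_rfl⟩
    have hne : S.Nonempty := Finset.card_pos.1 (by omega)
    obtain ⟨t, ht, hmin⟩ := S.exists_min_image l hne
    have hcard := Finset.card_erase_add_one ht
    obtain ⟨T, hTS, hT, hle⟩ := ih (S.erase t) (Finset.erase_ssubset ht) (by omega)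
    refine ⟨T, hTS.trans (Finset.erase_subset _ _), hT, ?_⟩
    have hsum := Finset.add_sum_erase S l ht
    have h1 : ((S.erase t).card : ℝ) * l t ≤ ∑ i ∈ S.erase t, l i := by
      rw [← nsmul_eq_mul]
      exact Finset.card_nsmul_le_sum _ _ _ fun i hi => hmin i (Finset.mem_of_mem_erase hi)
    have h2 : (s : ℝ) * l t ≤ ∑ i ∈ T, l i := by
      rw [← hT, ← nsmul_eq_mul]
      exact Finset.card_nsmul_le_sum _ _ _ fun i hi =>
        hmin i (Finset.mem_of_mem_erase (hTS hi))
    rw [← hsum, ← hcard]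
    push_cast
    linarith

theorem mul_zeroNorm_le_dot {ν : ℕ} {c : ℝ} {ξ y : Fin ν → ℝ} (hξ : ∀ j, c ≤ ξ j)
    (hy : ∀ j, y j = 0 ∨ y j = 1) : c * zeroNorm y ≤ dot ξ y := by
  rw [zeroNorm, dot, Finset.card_filter, Nat.cast_sum, Finset.mul_sum]
  refine Finset.sum_le_sum fun j _ => ?_
  rcases hy j with h | h <;> simp [h, hξ j]

theorem dot_le_mul_zeroNorm {ν : ℕ} {c : ℝ} {ξ y : Fin ν → ℝ} (hξ : ∀ j, ξ j ≤ c)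
    (hy : ∀ j, y j = 0 ∨ y j = 1) : dot ξ y ≤ c * zeroNorm y := by
  rw [zeroNorm, dot, Finset.card_filter, Nat.cast_sum, Finset.mul_sum]
  refine Finset.sum_le_sum fun j _ => ?_
  rcases hy j with h | h <;> simp [h, hξ j]

/-- If `k` policies attain worst-case cost `w` with all costs in `[0, b]`, some `s` of them attain
worst-case cost at most `w + b (k - s) / (s + 1)`. -/
theorem exists_subfamily_iInf_dot_le {ν s k : ℕ} {U : Set (Fin ν → ℝ)} (hU : Convex ℝ U)
    (hUne : U.Nonempty) (hs : 1 ≤ s) (hsk : s < k) (ys : Fin k → Fin ν → ℝ) {b w : ℝ}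
    (h0 : ∀ ξ ∈ U, ∀ i, 0 ≤ dot ξ (ys i)) (hb : ∀ ξ ∈ U, ∀ i, dot ξ (ys i) ≤ b)
    (hw : ∀ ξ ∈ U, ⨅ i, dot ξ (ys i) ≤ w) :
    ∃ e : Fin s → Fin k, ∀ ξ ∈ U,
      ⨅ i, dot ξ (ys (e i)) ≤ w + b * (((k : ℝ) - s) / ((s : ℝ) + 1)) := by
  have : Nonempty (Fin k) := ⟨⟨0, by omega⟩⟩
  have : Nonempty (Fin s) := ⟨⟨0, by omega⟩⟩
  let L : (Fin ν → ℝ) →ₗ[ℝ] (Fin k → ℝ) :=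
    { toFun := fun ξ i => dot ξ (ys i)
      map_add' := fun ξ η => by
        ext i; simp [dot, add_mul, Finset.sum_add_distrib]
      map_smul' := fun c ξ => by
        ext i; simp [dot, mul_assoc, Finset.mul_sum] }
  obtain ⟨l, hl0, hl1, hl⟩ := exists_convex_weights_le (hU.linear_image L) (hUne.image L) w (by
    rintro _ ⟨ξ, hξ, rfl⟩
    obtain ⟨i, hi⟩ := exists_eq_ciInf_of_finite (f := fun i => dot ξ (ys i))
    exact ⟨i, hi.le.trans (hw ξ hξ)⟩)
  obtain ⟨T, -, hT, hTl⟩ := exists_subset_card_mul_sum_le l s Finset.univ (by simpa using hsk.le)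
  refine ⟨T.orderEmbOfFin hT, fun ξ hξ => ?_⟩
  set v := ⨅ i, dot ξ (ys (T.orderEmbOfFin hT i)) with hv
  have hvT : ∀ i ∈ T, v ≤ dot ξ (ys i) := by
    intro i hi
    have : i ∈ Set.range (T.orderEmbOfFin hT) := by
      rw [Finset.range_orderEmbOfFin]; exact hi
    obtain ⟨j, rfl⟩ := this
    exact ciInf_le (Set.finite_range _).bddBelow j
  have hvb : v ≤ b := by
    obtain ⟨j⟩ := ‹Nonempty (Fin s)›
    exact (ciInf_le (Set.finite_range _).bddBelow j).trans (hb ξ hξ _)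
  have hb0 : 0 ≤ b := (h0 ξ hξ ⟨0, by omega⟩).trans (hb ξ hξ _)
  have hlξ : ∑ i, l i * dot ξ (ys i) ≤ w := hl _ ⟨ξ, hξ, rfl⟩
  have hsub : ∑ i ∈ T, l i * dot ξ (ys i) ≤ ∑ i, l i * dot ξ (ys i) :=
    Finset.sum_le_sum_of_subset_of_nonneg (Finset.subset_univ T) fun i _ _ =>
      mul_nonneg (hl0 i) (h0 ξ hξ i)
  have hvsum : (∑ i ∈ T, l i) * v ≤ ∑ i ∈ T, l i * dot ξ (ys i) := by
    rw [Finset.sum_mul]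
    exact Finset.sum_le_sum fun i hi => mul_le_mul_of_nonneg_left (hvT i hi) (hl0 i)
  have hT1 : ∑ i ∈ T, l i ≤ 1 := hl1 ▸
    Finset.sum_le_sum_of_subset_of_nonneg (Finset.subset_univ T) fun i _ _ => hl0 i
  have hskR : (s : ℝ) + 1 ≤ k := by exact_mod_cast hsk
  have hrest : 1 - ∑ i ∈ T, l i ≤ ((k : ℝ) - s) / ((s : ℝ) + 1) := by
    rw [le_div_iff₀ (by positivity)]
    rw [hl1, Finset.card_univ, Fintype.card_fin] at hTl
    nlinarith
  nlinarith [mul_le_mul_of_nonneg_left hvb (sub_nonneg.2 hT1),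
    mul_le_mul_of_nonneg_left hrest hb0]

/-- Assume `p > 0` and `dᵀx ≥ 0` for every `x ∈ X`. For `1 ≤ s < k ≤ n`,
`adapt(s) ≤ (1 + M̃·(k−s)/(s+1))·adapt(k)` with `M̃ = (M_∞/m_∞)·(p̄/p)`; in particular
if `p = p̄` then `adapt(s) ≤ (1 + (M_∞/m_∞)·(k−s)/(s+1))·adapt(k)`. -/
theorem stmt16 (m n : ℕ) (hm : 0 < m) (hn : 0 < n)
    (X : Set (Fin m → ℝ)) (hXne : X.Nonempty) (hXcomp : IsCompact X)
    (d : Fin m → ℝ)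
    (Y : (Fin m → ℝ) → Set (Fin n → ℝ))
    (hYfin : ∀ x ∈ X, (Y x).Finite) (hYne : ∀ x ∈ X, (Y x).Nonempty)
    (hYbin : ∀ x ∈ X, ∀ y ∈ Y x, ∀ j, y j = 0 ∨ y j = 1)
    (U : Set (Fin n → ℝ)) (hUne : U.Nonempty) (hUcomp : IsCompact U) (hUconv : Convex ℝ U)
    (m_inf M_inf : ℝ) (hminf : 0 < m_inf) (hmM : m_inf ≤ M_inf)
    (hxi : ∀ ξ ∈ U, ∀ j, m_inf ≤ ξ j ∧ ξ j ≤ M_inf)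
    (p pbar : ℝ) (hp0 : 0 ≤ p) (hppbar : p ≤ pbar)
    (hpy : ∀ x ∈ X, ∀ y ∈ Y x, p ≤ zeroNorm y ∧ zeroNorm y ≤ pbar)
    (hppos : 0 < p) (hd : ∀ x ∈ X, 0 ≤ dot d x)
    (s k : ℕ) (hs : 1 ≤ s) (hsk : s < k) (hkn : k ≤ n) :
    adaptVal X d Y U s ≤
      (1 + (M_inf / m_inf) * (pbar / p) * (((k : ℝ) - s) / ((s : ℝ) + 1))) *
        adaptVal X d Y U k ∧
    (p = pbar →
      adaptVal X d Y U s ≤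
        (1 + (M_inf / m_inf) * (((k : ℝ) - s) / ((s : ℝ) + 1))) * adaptVal X d Y U k) := by
  have hC : adaptVal X d Y U s ≤
      (1 + (M_inf / m_inf) * (pbar / p) * (((k : ℝ) - s) / ((s : ℝ) + 1))) *
        adaptVal X d Y U k := by
    have : Nonempty (Fin k) := ⟨⟨0, by omega⟩⟩
    have : Nonempty (Fin s) := ⟨⟨0, by omega⟩⟩
    have hM0 : 0 < M_inf := hminf.trans_le hmM
    have hpb0 : 0 < pbar := hppos.trans_le hppbar
    have hskR : (s : ℝ) < k := by exact_mod_cast hsk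
    set r : ℝ := ((k : ℝ) - s) / ((s : ℝ) + 1) with hr
    have hr0 : 0 ≤ r := div_nonneg (by linarith) (by positivity)
    have hlow : ∀ x ∈ X, ∀ y ∈ Y x, ∀ ξ ∈ U, m_inf * p ≤ dot ξ y := fun x hx y hy ξ hξ =>
      (mul_le_mul_of_nonneg_left (hpy x hx y hy).1 hminf.le).trans
        (mul_zeroNorm_le_dot (fun j => (hxi ξ hξ j).1) (hYbin x hx y hy))
    have hup : ∀ x ∈ X, ∀ y ∈ Y x, ∀ ξ ∈ U, dot ξ y ≤ M_inf * pbar := fun x hx y hy ξ hξ =>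
      (dot_le_mul_zeroNorm (fun j => (hxi ξ hξ j).2) (hYbin x hx y hy)).trans
        (mul_le_mul_of_nonneg_left (hpy x hx y hy).2 hM0.le)
    have hmp : 0 < m_inf * p := mul_pos hminf hppos
    set C : ℝ := 1 + M_inf / m_inf * (pbar / p) * r with hCdef
    have hCpos : 0 < C := by positivity
    rw [← div_le_iff₀' hCpos]
    refine le_csInf ?_ ?_
    · obtain ⟨x, hx⟩ := hXne
      obtain ⟨y, hy⟩ := hYne x hx
      exact ⟨_, x, hx, fun _ => y, fun _ => hy, rfl⟩
    rintro _ ⟨x, hx, ys, hys, rfl⟩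
    set v := sSup ((fun ξ => dot d x + ⨅ i, dot ξ (ys i)) '' U) with hv
    have hbdd : BddAbove ((fun ξ => dot d x + ⨅ i, dot ξ (ys i)) '' U) := by
      refine ⟨dot d x + M_inf * pbar, ?_⟩
      rintro _ ⟨ξ, hξ, rfl⟩
      obtain ⟨i⟩ := ‹Nonempty (Fin k)›
      exact add_le_add le_rfl ((ciInf_le (Set.finite_range _).bddBelow i).trans
        (hup x hx _ (hys i) ξ hξ))
    have hle : ∀ ξ ∈ U, dot d x + ⨅ i, dot ξ (ys i) ≤ v := fun ξ hξ =>
      le_csSup hbdd ⟨ξ, hξ, rfl⟩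
    have hvlow : m_inf * p ≤ v := by
      obtain ⟨ξ, hξ⟩ := hUne
      have h1 := hle ξ hξ
      have h2 : m_inf * p ≤ ⨅ i, dot ξ (ys i) := le_ciInf fun i => hlow x hx _ (hys i) ξ hξ
      linarith [hd x hx]
    obtain ⟨e, he⟩ := exists_subfamily_iInf_dot_le (b := M_inf * pbar) (w := v - dot d x)
      hUconv hUne hs hsk ys
      (fun ξ hξ i => hmp.le.trans (hlow x hx _ (hys i) ξ hξ))
      (fun ξ hξ i => hup x hx _ (hys i) ξ hξ) (fun ξ hξ => by linarith [hle ξ hξ])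
    rw [div_le_iff₀' hCpos]
    have hadd : M_inf * pbar * r ≤ M_inf / m_inf * (pbar / p) * r * v := by
      have h1 : M_inf * pbar * r = M_inf / m_inf * (pbar / p) * r * (m_inf * p) := by
        field_simp
      rw [h1]
      exact mul_le_mul_of_nonneg_left hvlow (by positivity)
    have hmem : adaptVal X d Y U s ≤
        sSup ((fun ξ => dot d x + ⨅ i, dot ξ (ys (e i))) '' U) := by
      refine csInf_le ⟨0, ?_⟩ ⟨x, hx, fun i => ys (e i), fun i => hys _, rfl⟩
      rintro _ ⟨x', hx', zs, hzs, rfl⟩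
      apply Real.sSup_nonneg
      rintro _ ⟨ξ, hξ, rfl⟩
      exact add_nonneg (hd x' hx') (Real.iInf_nonneg fun i =>
        hmp.le.trans (hlow x' hx' _ (hzs i) ξ hξ))
    refine hmem.trans (csSup_le (hUne.image _) ?_)
    rintro _ ⟨ξ, hξ, rfl⟩
    have h1 := he ξ hξ
    rw [← hr] at h1
    have h2 : C * v = v + M_inf / m_inf * (pbar / p) * r * v := by rw [hCdef]; ring
    rw [h2]
    linarith
  refine ⟨hC, fun hpp => ?_⟩
  rwa [← hpp, div_self hppos.ne', mul_one] at hC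
end
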